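/- arXiv:2605.19904 — 2 statements merged into one kernel-verified Lean document; each statement's English description precedes it below -/
import Mathlib

section
/- Let S be a nonempty finite word over the alphabet [m]. Then the sum E(S) := ∑_{w ∈ Z(S)} |w| · P(w) converges and E(S) = ∑_{R ∈ overlap(S)} 1 / P(R). -/
/-- The probability of a given finite word over the alphabet `Fin m`, where face `i`
has probability `p i`. -/
def dieP {m : ℕ} (p : Fin m → ℝ) (w : List (Fin m)) : ℝ := (w.map p).prod

/-- The number of occurrences of `S` as a factor (consecutive subword) of `w`. -/
def numOccs {m : ℕ} (S w : List (Fin m)) : ℕ :=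
  ((Finset.range (w.length + 1)).filter fun i => (w.drop i).take S.length = S).card

/-- `dieZ S` is the set of finite words over `Fin m` in which `S` occurs exactly once
as a factor, namely as a suffix. -/
def dieZ {m : ℕ} (S : List (Fin m)) : Set (List (Fin m)) := {w | S <:+ w ∧ numOccs S w = 1}

/-- The lengths, shifted down by one, of the overlaps of `S`, i.e. of the nonempty words
that are simultaneously a prefix and a suffix of `S`.  The overlap of `S` of length
`i + 1` (for `i ∈ overlapLens S`) is `S.take (i + 1)`, so that summation over the set of
overlaps of `S` is summation of `S.take (i + 1)` over `i ∈ overlapLens S`. -/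
def overlapLens {m : ℕ} (S : List (Fin m)) : Finset ℕ :=
  (Finset.range S.length).filter fun i => S.take (i + 1) <:+ S

/-- The expected number of die rolls `E(S) = ∑_{w ∈ Z(S)} |w| P(w)` needed to produce `S`. -/
noncomputable def dieE {m : ℕ} (p : Fin m → ℝ) (S : List (Fin m)) : ℝ :=
  ∑' w : dieZ S, (w.1.length : ℝ) * dieP p w.1

open Filter Topology

section Words

variable {α : Type*} {S w u v : List α}

/-- `S` occurs in `w`, and every occurrence of `S` in `w` is terminal. -/
def FirstOcc (S w : List α) : Prop :=
  S <:+ w ∧ ∀ y z, w = y ++ S ++ z → z = []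

theorem firstOcc_append_singleton {a : α} (h : ¬ S <:+: w) (h' : S <:+: w ++ [a]) :
    FirstOcc S (w ++ [a]) := by
  have key : ∀ y z, w ++ [a] = y ++ S ++ z → z = [] := by
    intro y z e
    rcases List.eq_nil_or_concat' z with rfl | ⟨z', b, rfl⟩
    · rfl
    · rw [← List.append_assoc] at e
      exact absurd ⟨y, z', (List.append_inj' e rfl).1.symm⟩ h
  obtain ⟨y, z, e⟩ := h'
  refine ⟨⟨y, ?_⟩, key⟩
  have := key y z e.symm
  subst this
  simpa using e

theorem FirstOcc.not_infix (h : FirstOcc S (w ++ v)) (hv : v ≠ []) : ¬ S <:+: w := by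
  rintro ⟨y, z, rfl⟩
  have := h.2 y (z ++ v) (by simp)
  simp_all

theorem FirstOcc.eq_nil (hu : FirstOcc S u) (huv : FirstOcc S (u ++ v)) : v = [] := by
  obtain ⟨y, rfl⟩ := hu.1
  exact huv.2 y v rfl

theorem FirstOcc.eq_of_append_eq {x y : List α} (hu : FirstOcc S u) (hv : FirstOcc S v)
    (h : u ++ x = v ++ y) : u = v := by
  rcases List.append_eq_append_iff.1 h with ⟨t, rfl, -⟩ | ⟨t, rfl, -⟩
  · simp [hu.eq_nil hv]
  · simp [hv.eq_nil hu]

/-- If `S` does not occur in `w`, its first occurrence in `w ++ S` ends after an overlap. -/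
theorem exists_firstOcc_append_take (h : ¬ S <:+: w) :
    ∃ j < S.length, S.take (j + 1) <:+ S ∧ FirstOcc S (w ++ S.take (j + 1)) := by
  classical
  have hex : ∃ k, S <:+: w ++ S.take k :=
    ⟨S.length, by simpa using (List.suffix_append w S).isInfix⟩
  obtain ⟨j, hj⟩ : ∃ j, Nat.find hex = j + 1 := by
    refine Nat.exists_eq_succ_of_ne_zero fun h0 => h ?_
    simpa [h0] using Nat.find_spec hex
  have h1 : S <:+: w ++ S.take (j + 1) := hj ▸ Nat.find_spec hex
  have h2 : ¬ S <:+: w ++ S.take j := Nat.find_min hex (by omega)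
  have hlt : j < S.length := by
    have : Nat.find hex ≤ S.length :=
      Nat.find_min' hex (by simpa using (List.suffix_append w S).isInfix)
    omega
  have e : w ++ S.take (j + 1) = (w ++ S.take j) ++ [S[j]] := by
    simp [List.take_append_getElem]
  have hF : FirstOcc S (w ++ S.take (j + 1)) := by
    rw [e] at h1 ⊢
    exact firstOcc_append_singleton h2 h1
  exact ⟨j, hlt, List.suffix_of_suffix_length_le (List.suffix_append _ _) hF.1 (by simp), hF⟩

/-- A word with first occurrence of `S` at its end ends with every overlap of `S`. -/
theorem FirstOcc.exists_eq_append_take {j : ℕ} (hu : FirstOcc S u) (h : S.take j <:+ S) :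
    ∃ w, u = w ++ S.take j := by
  obtain ⟨w, e⟩ := h.trans hu.1
  exact ⟨w, e.symm⟩

end Words

section Dice

variable {m : ℕ} {p : Fin m → ℝ} {S w : List (Fin m)}

theorem dieP_append (p : Fin m → ℝ) (u v : List (Fin m)) :
    dieP p (u ++ v) = dieP p u * dieP p v := by
  simp [dieP]

theorem dieP_pos (hp : ∀ i, 0 < p i) (w : List (Fin m)) : 0 < dieP p w :=
  List.prod_pos (by simpa using fun i _ => hp i)

theorem mem_dieZ_iff (hS : S ≠ []) : w ∈ dieZ S ↔ FirstOcc S w := by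
  have hpos := List.length_pos_iff.2 hS
  have occ : ∀ i, (w.drop i).take S.length = S ↔ ∃ y z, w = y ++ S ++ z ∧ y.length = i := by
    intro i
    constructor
    · intro h
      refine ⟨w.take i, (w.drop i).drop S.length, ?_, ?_⟩
      · conv_lhs => rw [← List.take_append_drop i w, ← List.take_append_drop S.length (w.drop i), h]
        simp
      · have := congrArg List.length h
        simp at this ⊢
        omega
    · rintro ⟨y, z, rfl, rfl⟩
      simp
  simp only [dieZ, Set.mem_ofPred_eq, FirstOcc, numOccs]
  refine and_congr_right fun ⟨x, hx⟩ => ?_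
  have hx' : x.length ∈ (Finset.range (w.length + 1)).filter
      fun i => (w.drop i).take S.length = S := by
    rw [Finset.mem_filter, occ]
    exact ⟨by simp [← hx], x, [], by simp [hx], rfl⟩
  constructor
  · intro h y z e
    have hy : y.length ∈ (Finset.range (w.length + 1)).filter
        fun i => (w.drop i).take S.length = S := by
      rw [Finset.mem_filter, occ]
      exact ⟨by simp [e], y, z, e, rfl⟩
    have := Finset.card_le_one.1 h.le _ hx' _ hy
    have hl := congrArg List.length (hx.trans e)
    simp at hl
    exact List.length_eq_zero_iff.1 (by omega)
  · intro h
    rw [Finset.card_eq_one]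
    refine ⟨x.length, Finset.eq_singleton_iff_unique_mem.2 ⟨hx', fun i hi => ?_⟩⟩
    rw [Finset.mem_filter, occ] at hi
    obtain ⟨-, y, z, e, rfl⟩ := hi
    have hz := h y z e
    have hl := congrArg List.length (hx.trans e)
    simp [hz] at hl
    omega

open Classical in
/-- The words of length `n` satisfying a predicate. -/
noncomputable def wordsWith (Q : List (Fin m) → Prop) (n : ℕ) : Finset (List (Fin m)) :=
  (List.finite_length_eq (Fin m) n).toFinset.filter Q

theorem mem_wordsWith {Q : List (Fin m) → Prop} {n : ℕ} :
    w ∈ wordsWith Q n ↔ w.length = n ∧ Q w := by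
  simp [wordsWith]

/-- The probability that `S` has not occurred among the first `n` rolls. -/
noncomputable def avoidProb (p : Fin m → ℝ) (S : List (Fin m)) (n : ℕ) : ℝ :=
  ∑ w ∈ wordsWith (fun w => ¬ S <:+: w) n, dieP p w

/-- The probability that `S` is first completed at roll `n`. -/
noncomputable def firstProb (p : Fin m → ℝ) (S : List (Fin m)) (n : ℕ) : ℝ :=
  ∑ w ∈ wordsWith (FirstOcc S) n, dieP p w

theorem avoidProb_nonneg (hp : ∀ i, 0 < p i) (n : ℕ) : 0 ≤ avoidProb p S n :=
  Finset.sum_nonneg fun w _ => (dieP_pos hp w).le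

theorem firstProb_nonneg (hp : ∀ i, 0 < p i) (n : ℕ) : 0 ≤ firstProb p S n :=
  Finset.sum_nonneg fun w _ => (dieP_pos hp w).le

theorem firstProb_eq_zero {n : ℕ} (h : n < S.length) : firstProb p S n = 0 := by
  refine Finset.sum_eq_zero fun w hw => ?_
  obtain ⟨hl, hF⟩ := mem_wordsWith.1 hw
  have := hF.1.length_le
  omega

theorem avoidProb_zero (hS : S ≠ []) : avoidProb p S 0 = 1 := by
  have : wordsWith (fun w => ¬ S <:+: w) 0 = {[]} := by
    ext w
    simp only [mem_wordsWith, List.length_eq_zero_iff, Finset.mem_singleton]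
    exact ⟨fun h => h.1, fun h => ⟨h, by simpa [h] using hS⟩⟩
  simp [avoidProb, this, dieP]

theorem avoidProb_eq_add (hsum : ∑ i, p i = 1) (n : ℕ) :
    avoidProb p S n = avoidProb p S (n + 1) + firstProb p S (n + 1) := by
  have hd : Disjoint (wordsWith (fun w => ¬ S <:+: w) (n + 1)) (wordsWith (FirstOcc S) (n + 1)) :=
    Finset.disjoint_left.2 fun w h h' =>
      (mem_wordsWith.1 h).2 (mem_wordsWith.1 h').2.1.isInfix
  calc avoidProb p S n
      = ∑ x ∈ wordsWith (fun w => ¬ S <:+: w) n ×ˢ Finset.univ, dieP p (x.1 ++ [x.2]) := by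
        simp [Finset.sum_product, avoidProb, ← Finset.mul_sum, dieP, hsum]
    _ = ∑ w ∈ wordsWith (fun w => ¬ S <:+: w) (n + 1) ∪ wordsWith (FirstOcc S) (n + 1),
          dieP p w := by
        refine Finset.sum_nbij (fun x => x.1 ++ [x.2]) ?_ ?_ ?_ fun _ _ => rfl
        · rintro ⟨w, a⟩ h
          simp only [Finset.mem_product, Finset.mem_univ, and_true, mem_wordsWith] at h
          simp only [Finset.mem_union, mem_wordsWith]
          by_cases h' : S <:+: w ++ [a]
          · exact Or.inr ⟨by simp [h.1], firstOcc_append_singleton h.2 h'⟩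
          · exact Or.inl ⟨by simp [h.1], h'⟩
        · rintro ⟨w, a⟩ - ⟨w', a'⟩ - h
          simpa using h
        · intro u hu
          simp only [Finset.mem_coe, Finset.mem_union, mem_wordsWith] at hu
          have hl : u.length = n + 1 := by tauto
          rcases List.eq_nil_or_concat' u with rfl | ⟨w, a, rfl⟩
          · simp at hl
          · refine ⟨(w, a), ?_, rfl⟩
            simp only [Finset.mem_coe, Finset.mem_product, Finset.mem_univ, and_true,
              mem_wordsWith]
            refine ⟨by simpa using hl, ?_⟩
            rcases hu with hu | hu
            · exact fun h => hu.2 (h.trans (List.prefix_append _ _).isInfix)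
            · exact hu.2.not_infix (by simp)
    _ = _ := Finset.sum_union hd

theorem avoidProb_eq_sum (hp : ∀ i, 0 < p i) (n : ℕ) :
    avoidProb p S n =
      ∑ j ∈ overlapLens S, (dieP p (S.take (j + 1)))⁻¹ * firstProb p S (n + (j + 1)) := by
  simp only [firstProb, Finset.mul_sum]
  rw [Finset.sum_sigma', avoidProb]
  have hmem : ∀ x ∈ (overlapLens S).sigma fun j => wordsWith (FirstOcc S) (n + (j + 1)),
      x.2 = x.2.take n ++ S.take (x.1 + 1) ∧ (x.2.take n).length = n ∧ x.1 < S.length ∧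
        FirstOcc S x.2 := by
    rintro ⟨j, u⟩ h
    simp only [Finset.mem_sigma, overlapLens, Finset.mem_filter, Finset.mem_range,
      mem_wordsWith] at h
    obtain ⟨⟨hj, ho⟩, hl, hF⟩ := h
    obtain ⟨w, rfl⟩ := hF.exists_eq_append_take ho
    have hw : w.length = n := by simp at hl; omega
    refine ⟨?_, ?_, hj, hF⟩ <;> simp [← hw]
  symm
  refine Finset.sum_nbij (fun x => x.2.take n) ?_ ?_ ?_ ?_
  · intro x hx
    obtain ⟨e, hl, hj, hF⟩ := hmem x hx
    rw [e] at hF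
    refine mem_wordsWith.2 ⟨hl, hF.not_infix fun h => ?_⟩
    have := congrArg List.length h
    simp only [List.length_take, List.length_nil] at this
    omega
  · rintro ⟨j, u⟩ hx ⟨j', u'⟩ hx' h
    obtain ⟨e, hl, hj, hF⟩ := hmem _ hx
    obtain ⟨e', hl', hj', hF'⟩ := hmem _ hx'
    simp only at h e e' hl hl' hj hj' hF hF'
    have huv : u = u' := by
      refine hF.eq_of_append_eq hF' (x := S.drop (j + 1)) (y := S.drop (j' + 1)) ?_
      rw [e, e', h]
      simp
    subst huv
    have := congrArg List.length (e.symm.trans e')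
    simp only [List.length_append, List.length_take] at this
    obtain rfl : j = j' := by omega
    rfl
  · intro w hw
    obtain ⟨hl, hw⟩ := mem_wordsWith.1 hw
    obtain ⟨j, hj, ho, hF⟩ := exists_firstOcc_append_take hw
    refine ⟨⟨j, w ++ S.take (j + 1)⟩, ?_, by simp [← hl]⟩
    simp only [Finset.mem_coe, Finset.mem_sigma, overlapLens, Finset.mem_filter,
      Finset.mem_range, mem_wordsWith]
    exact ⟨⟨hj, ho⟩, by simp [hl]; omega, hF⟩
  · intro x hx
    obtain ⟨e, -⟩ := hmem x hx
    conv_lhs => rw [e, dieP_append]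
    have := (dieP_pos hp (S.take (x.1 + 1))).ne'
    field_simp

theorem sum_range_firstProb (hsum : ∑ i, p i = 1) (hS : S ≠ []) (n : ℕ) :
    ∑ k ∈ Finset.range (n + 1), firstProb p S k = 1 - avoidProb p S n := by
  induction n with
  | zero => simp [firstProb_eq_zero (List.length_pos_iff.2 hS), avoidProb_zero hS]
  | succ n ih => rw [Finset.sum_range_succ, ih, avoidProb_eq_add hsum n]; ring

theorem summable_firstProb (hp : ∀ i, 0 < p i) (hsum : ∑ i, p i = 1) (hS : S ≠ []) :
    Summable (firstProb p S) := by
  refine summable_of_sum_range_le (c := 1) (firstProb_nonneg hp) fun n => ?_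
  calc ∑ k ∈ Finset.range n, firstProb p S k
      ≤ ∑ k ∈ Finset.range (n + 1), firstProb p S k :=
        Finset.sum_le_sum_of_subset_of_nonneg (by simp) fun _ _ _ => firstProb_nonneg hp _
    _ ≤ 1 := by
        rw [sum_range_firstProb hsum hS]
        linarith [avoidProb_nonneg (S := S) hp n]

theorem summable_avoidProb (hp : ∀ i, 0 < p i) (hsum : ∑ i, p i = 1) (hS : S ≠ []) :
    Summable (avoidProb p S) := by
  rw [funext (avoidProb_eq_sum (S := S) hp)]
  exact summable_sum fun j _ =>
    ((summable_nat_add_iff (j + 1)).2 (summable_firstProb hp hsum hS)).mul_left _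

theorem hasSum_firstProb (hp : ∀ i, 0 < p i) (hsum : ∑ i, p i = 1) (hS : S ≠ []) :
    HasSum (firstProb p S) 1 := by
  rw [(summable_firstProb hp hsum hS).hasSum_iff_tendsto_nat, ← tendsto_add_atTop_iff_nat 1]
  simp only [sum_range_firstProb hsum hS]
  simpa using (summable_avoidProb hp hsum hS).tendsto_atTop_zero.const_sub 1

theorem hasSum_avoidProb (hp : ∀ i, 0 < p i) (hsum : ∑ i, p i = 1) (hS : S ≠ []) :
    HasSum (avoidProb p S) (∑ j ∈ overlapLens S, (dieP p (S.take (j + 1)))⁻¹) := by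
  rw [funext (avoidProb_eq_sum (S := S) hp)]
  refine hasSum_sum fun j hj => ?_
  have hj : j < S.length := by
    simp only [overlapLens, Finset.mem_filter, Finset.mem_range] at hj
    exact hj.1
  have h0 : ∑ k ∈ Finset.range (j + 1), firstProb p S k = 0 := by
    refine Finset.sum_eq_zero fun k hk => firstProb_eq_zero ?_
    have := Finset.mem_range.1 hk
    omega
  have := (hasSum_nat_add_iff' (j + 1)).2 (hasSum_firstProb hp hsum hS)
  rw [h0, sub_zero] at this
  simpa using this.mul_left (dieP p (S.take (j + 1)))⁻¹

theorem sum_range_mul_firstProb (hsum : ∑ i, p i = 1) (n : ℕ) :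
    ∑ k ∈ Finset.range (n + 1), (k : ℝ) * firstProb p S k =
      ∑ k ∈ Finset.range n, avoidProb p S k - n * avoidProb p S n := by
  induction n with
  | zero => simp
  | succ n ih =>
    rw [Finset.sum_range_succ, ih, Finset.sum_range_succ, avoidProb_eq_add hsum n]
    push_cast
    ring

theorem tendsto_mul_avoidProb (hp : ∀ i, 0 < p i) (hsum : ∑ i, p i = 1) (hS : S ≠ [])
    (hs : Summable fun n : ℕ => (n : ℝ) * firstProb p S n) :
    Tendsto (fun n : ℕ => (n : ℝ) * avoidProb p S n) atTop (𝓝 0) := by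
  have hlim := tendsto_sum_nat_add fun n : ℕ => (n : ℝ) * firstProb p S n
  rw [← tendsto_add_atTop_iff_nat 1] at hlim
  refine squeeze_zero (fun n => mul_nonneg n.cast_nonneg (avoidProb_nonneg hp n)) (fun n => ?_) hlim
  have htail := (hasSum_nat_add_iff' (n + 1)).2 (hasSum_firstProb hp hsum hS)
  rw [sum_range_firstProb hsum hS, sub_sub_cancel] at htail
  refine hasSum_le (fun k => ?_) (htail.mul_left (n : ℝ))
    ((summable_nat_add_iff (n + 1)).2 hs).hasSum
  refine mul_le_mul_of_nonneg_right ?_ (firstProb_nonneg hp _)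
  push_cast
  linarith [(k.cast_nonneg : (0 : ℝ) ≤ k)]

theorem hasSum_mul_firstProb (hp : ∀ i, 0 < p i) (hsum : ∑ i, p i = 1) (hS : S ≠ []) :
    HasSum (fun n : ℕ => (n : ℝ) * firstProb p S n)
      (∑ j ∈ overlapLens S, (dieP p (S.take (j + 1)))⁻¹) := by
  have ha := hasSum_avoidProb hp hsum hS
  have hnn : ∀ n : ℕ, 0 ≤ (n : ℝ) * firstProb p S n :=
    fun n => mul_nonneg n.cast_nonneg (firstProb_nonneg hp n)
  have hs : Summable fun n : ℕ => (n : ℝ) * firstProb p S n := by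
    refine summable_of_sum_range_le hnn (c := ∑' n, avoidProb p S n) fun n => ?_
    calc ∑ k ∈ Finset.range n, (k : ℝ) * firstProb p S k
        ≤ ∑ k ∈ Finset.range (n + 1), (k : ℝ) * firstProb p S k :=
          Finset.sum_le_sum_of_subset_of_nonneg (by simp) fun _ _ _ => hnn _
      _ ≤ ∑ k ∈ Finset.range n, avoidProb p S k := by
          rw [sum_range_mul_firstProb hsum]
          exact sub_le_self _ (mul_nonneg n.cast_nonneg (avoidProb_nonneg hp n))
      _ ≤ _ := ha.summable.sum_le_tsum _ fun k _ => avoidProb_nonneg hp k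
  rw [hs.hasSum_iff_tendsto_nat, ← tendsto_add_atTop_iff_nat 1]
  simp only [sum_range_mul_firstProb hsum]
  simpa using ha.tendsto_sum_nat.sub (tendsto_mul_avoidProb hp hsum hS hs)

theorem hasSum_length_mul_dieP (hp : ∀ i, 0 < p i) (hS : S ≠ []) {c : ℝ}
    (h : HasSum (fun n : ℕ => (n : ℝ) * firstProb p S n) c) :
    HasSum (fun w : dieZ S => (w.1.length : ℝ) * dieP p w.1) c := by
  let e := Equiv.sigmaFiberEquiv fun w : dieZ S => w.1.length
  let f : dieZ S → ℝ := fun w => (w.1.length : ℝ) * dieP p w.1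
  have hfib : ∀ n : ℕ, HasSum (fun w : {w : dieZ S // w.1.length = n} => f (e ⟨n, w⟩))
      ((n : ℝ) * firstProb p S n) := by
    intro n
    have hF := (wordsWith (FirstOcc S) n).hasSum fun w => (n : ℝ) * dieP p w
    rw [← Finset.mul_sum] at hF
    let g : {w : dieZ S // w.1.length = n} ≃ (wordsWith (FirstOcc S) n : Set (List (Fin m))) :=
      { toFun := fun w => ⟨w.1.1, mem_wordsWith.2 ⟨w.2, (mem_dieZ_iff hS).1 w.1.2⟩⟩
        invFun := fun w => ⟨⟨w.1, (mem_dieZ_iff hS).2 (mem_wordsWith.1 w.2).2⟩,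
          (mem_wordsWith.1 w.2).1⟩
        left_inv := fun _ => rfl
        right_inv := fun _ => rfl }
    convert g.hasSum_iff.2 hF using 2 with w
    · simp [f, e, g, w.2]
    · rfl
  rw [← e.hasSum_iff]
  have hs : Summable (f ∘ e) := by
    refine (summable_sigma_of_nonneg fun x =>
      mul_nonneg (Nat.cast_nonneg _) (dieP_pos hp _).le).2 ⟨fun n => (hfib n).summable, ?_⟩
    exact h.summable.congr fun n => ((hfib n).tsum_eq).symm
  have := hs.hasSum.sigma hfib
  rw [← this.unique h]
  exact hs.hasSum

end Dice

/-- `E(S) = ∑_{w ∈ Z(S)} |w| P(w)` converges and equals `∑_{R ∈ overlap(S)} 1/P(R)`. -/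
theorem stmt_12 (m : ℕ) (hm : 1 ≤ m) (p : Fin m → ℝ) (hp : ∀ i, 0 < p i)
    (hsum : ∑ i, p i = 1) (S : List (Fin m)) (hS : S ≠ []) :
    Summable (fun w : dieZ S => (w.1.length : ℝ) * dieP p w.1) ∧
      dieE p S = ∑ i ∈ overlapLens S, (dieP p (S.take (i + 1)))⁻¹ := by
  have h := hasSum_length_mul_dieP hp hS (hasSum_mul_firstProb hp hsum hS)
  exact ⟨h.summable, h.tsum_eq⟩
end

section
/- Let S be a nonempty finite word over the alphabet [m] and suppose the die is unbiased, i.e. p_1 = ⋯ = p_m = 1/m. Then E(S) = ∑_{R ∈ overlap(S)} m^{|R|}. -/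
/-- A word lies in `dieZ S` iff it ends in `S` and `S` does not occur before its last letter. -/
theorem mem_dieZ_iff_s13 {m : ℕ} {S : List (Fin m)} (hS : S ≠ []) (w : List (Fin m)) :
    w ∈ dieZ S ↔ S <:+ w ∧ ¬ S <:+: w.dropLast := by
  have hS0 : 0 < S.length := List.length_pos_iff.mpr hS
  refine and_congr_right fun hw => ?_
  obtain ⟨t, rfl⟩ := hw
  have hdrop : (t ++ S).dropLast = (t ++ S).take (t.length + S.length - 1) := by
    rw [List.dropLast_eq_take, List.length_append]
  have hmem : t.length ∈ (Finset.range ((t ++ S).length + 1)).filter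
      fun i => ((t ++ S).drop i).take S.length = S := by
    simp
  rw [numOccs, Finset.card_eq_one]
  constructor
  · rintro ⟨a, ha⟩ ⟨x, y, hxy⟩
    have hlen := congrArg List.length hxy
    simp only [List.length_append, List.length_dropLast] at hlen
    have hpre : x ++ S ++ y <+: t ++ S := by
      rw [hxy]; exact List.dropLast_prefix _
    obtain ⟨z, hz⟩ := hpre
    have hx : x.length ∈ (Finset.range ((t ++ S).length + 1)).filter
        fun i => ((t ++ S).drop i).take S.length = S := by
      rw [Finset.mem_filter, ← hz]
      simp
    rw [ha, Finset.mem_singleton] at hx hmem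
    omega
  · intro h
    refine ⟨t.length, Finset.eq_singleton_iff_unique_mem.mpr ⟨hmem, fun i hi => ?_⟩⟩
    rw [Finset.mem_filter, Finset.mem_range] at hi
    obtain ⟨hi, hocc⟩ := hi
    have hlen := congrArg List.length hocc
    simp only [List.length_take, List.length_drop, List.length_append] at hlen hi
    by_contra hne
    have hlt : i + S.length ≤ t.length + S.length - 1 := by omega
    have hfactor : ((t ++ S).drop i).take S.length <:+: (t ++ S).dropLast := by
      rw [List.take_drop, hdrop]
      exact (List.drop_suffix _ _).isInfix.trans (List.take_prefix_take_left hlt).isInfix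
    rw [hocc] at hfactor
    exact h hfactor

/-- The words of length `n` in which `S` does not occur. -/
def avoiders {m : ℕ} (S : List (Fin m)) (n : ℕ) : Set (List (Fin m)) :=
  {w | w.length = n ∧ ¬ S <:+: w}

/-- The words of length `n` in `dieZ S`. -/
def dieZOfLength {m : ℕ} (S : List (Fin m)) (n : ℕ) : Set (List (Fin m)) :=
  {w | w.length = n ∧ w ∈ dieZ S}

theorem avoiders_finite {m : ℕ} (S : List (Fin m)) (n : ℕ) : (avoiders S n).Finite :=
  (List.finite_length_eq (Fin m) n).subset fun _ hw => hw.1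

theorem dieZOfLength_finite {m : ℕ} (S : List (Fin m)) (n : ℕ) : (dieZOfLength S n).Finite :=
  (List.finite_length_eq (Fin m) n).subset fun _ hw => hw.1

theorem concat_mem_dieZ_iff {m : ℕ} {S : List (Fin m)} (hS : S ≠ []) (w : List (Fin m))
    (c : Fin m) : w ++ [c] ∈ dieZ S ↔ S <:+ w ++ [c] ∧ ¬ S <:+: w := by
  rw [mem_dieZ_iff_s13 hS, List.dropLast_concat]

theorem card_avoiders_mul {m : ℕ} {S : List (Fin m)} (hS : S ≠ []) (n : ℕ) :
    (avoiders S n).ncard * m = (avoiders S (n + 1)).ncard + (dieZOfLength S (n + 1)).ncard := by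
  have hdisj : Disjoint (avoiders S (n + 1)) (dieZOfLength S (n + 1)) :=
    Set.disjoint_left.mpr fun w hw hw' => hw.2 hw'.2.1.isInfix
  have himage : avoiders S (n + 1) ∪ dieZOfLength S (n + 1) =
      (fun x : List (Fin m) × Fin m => x.1 ++ [x.2]) '' (avoiders S n ×ˢ Set.univ) := by
    ext w
    rcases List.eq_nil_or_concat' w with rfl | ⟨u, c, rfl⟩
    · simp [avoiders, dieZOfLength]
    · simp only [avoiders, dieZOfLength, Set.mem_union, Set.mem_ofPred_eq, Set.mem_image,
        Set.mem_prod, Set.mem_univ, and_true, concat_mem_dieZ_iff hS, List.infix_concat_iff,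
        List.length_append, List.length_singleton, Prod.exists, List.append_singleton_inj]
      constructor
      · intro h
        exact ⟨u, c, ⟨by omega, by tauto⟩, rfl, rfl⟩
      · rintro ⟨u, c, ⟨h1, h2⟩, rfl, rfl⟩
        by_cases h : S <:+ u ++ [c]
        · exact Or.inr ⟨by omega, h, h2⟩
        · exact Or.inl ⟨by omega, by tauto⟩
  rw [← Set.ncard_union_eq hdisj (avoiders_finite _ _) (dieZOfLength_finite _ _), himage,
    Set.ncard_image_of_injective, Set.ncard_prod, Set.ncard_univ, Nat.card_eq_fintype_card,
    Fintype.card_fin]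
  rintro ⟨u, c⟩ ⟨v, d⟩ h
  simpa using h

theorem append_take_mem_dieZ_iff {m : ℕ} {S : List (Fin m)} (hS : S ≠ []) (w : List (Fin m))
    {i : ℕ} (hi : i < S.length) :
    w ++ S.take (i + 1) ∈ dieZ S ↔ S <:+ w ++ S.take (i + 1) ∧ ¬ S <:+: w ++ S.take i := by
  rw [List.take_succ_eq_append_getElem hi, ← List.append_assoc, concat_mem_dieZ_iff hS]

/-- Appending `S` to a word avoiding `S`, the first occurrence of `S` ends at a well-defined
letter of the appended copy. -/
theorem exists_append_take_mem_dieZ {m : ℕ} {S : List (Fin m)} (hS : S ≠ []) {w : List (Fin m)}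
    (hw : ¬ S <:+: w) : ∃ i < S.length, w ++ S.take (i + 1) ∈ dieZ S := by
  classical
  have hfull : S <:+: w ++ S.take S.length := by simpa using (List.suffix_append w S).isInfix
  have hex : ∃ k, S <:+: w ++ S.take k := ⟨S.length, hfull⟩
  have hle : Nat.find hex ≤ S.length := Nat.find_min' hex hfull
  have hmin : ∀ j < Nat.find hex, ¬ S <:+: w ++ S.take j := fun j hj => Nat.find_min hex hj
  have hspec := Nat.find_spec hex
  generalize Nat.find hex = k at *
  cases k with
  | zero => simp [hw] at hspec
  | succ i =>
    refine ⟨i, hle, (append_take_mem_dieZ_iff hS w hle).mpr ⟨?_, hmin i (Nat.lt_succ_self i)⟩⟩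
    rw [List.take_succ_eq_append_getElem hle, ← List.append_assoc] at hspec ⊢
    exact (List.infix_concat_iff.mp hspec).resolve_right (hmin i (Nat.lt_succ_self i))

theorem card_avoiders_eq_sum {m : ℕ} {S : List (Fin m)} (hS : S ≠ []) (n : ℕ) :
    (avoiders S n).ncard = ∑ i ∈ overlapLens S, (dieZOfLength S (n + (i + 1))).ncard := by
  classical
  let B : ℕ → Set (List (Fin m)) := fun i => {w | w.length = n ∧ w ++ S.take (i + 1) ∈ dieZ S}
  have hBfin : ∀ i, (B i).Finite := fun i =>
    (List.finite_length_eq (Fin m) n).subset fun _ hw => hw.1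
  have hlt : ∀ i ∈ overlapLens S, i < S.length := fun i hi => by
    simpa using (Finset.mem_filter.mp hi).1
  have hcover : avoiders S n = ⋃ i ∈ overlapLens S, B i := by
    ext w
    simp only [Set.mem_iUnion, exists_prop]
    constructor
    · rintro ⟨hlen, hw⟩
      obtain ⟨i, hi, hZ⟩ := exists_append_take_mem_dieZ hS hw
      refine ⟨i, Finset.mem_filter.mpr ⟨Finset.mem_range.mpr hi, ?_⟩, hlen, hZ⟩
      exact List.suffix_of_suffix_length_le (List.suffix_append _ _) hZ.1
        (by simp)
    · rintro ⟨i, hi, hlen, hZ⟩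
      exact ⟨hlen, fun h => ((append_take_mem_dieZ_iff hS w (hlt i hi)).mp hZ).2
        (h.trans (List.prefix_append _ _).isInfix)⟩
  have hdisj_lt : ∀ i j, j < S.length → i < j → Disjoint (B i) (B j) := by
    intro i j hj hij
    refine Set.disjoint_left.mpr fun w hi hj' => ?_
    refine ((append_take_mem_dieZ_iff hS w hj).mp hj'.2).2 (hi.2.1.isInfix.trans ?_)
    exact List.IsPrefix.isInfix
      ((List.prefix_append_right_inj w).mpr (List.take_prefix_take_left hij))
  have hdisj : (overlapLens S : Set ℕ).PairwiseDisjoint B := by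
    intro i hi j hj hij
    rcases lt_or_gt_of_ne hij with h | h
    · exact hdisj_lt i j (hlt j hj) h
    · exact (hdisj_lt j i (hlt i hi) h).symm
  have hcard : ∀ i ∈ overlapLens S, (B i).ncard = (dieZOfLength S (n + (i + 1))).ncard := by
    intro i hi
    have hil := hlt i hi
    have himage : dieZOfLength S (n + (i + 1)) = (fun w => w ++ S.take (i + 1)) '' B i := by
      ext z
      constructor
      · rintro ⟨hlen, hz⟩
        obtain ⟨w, rfl⟩ := (Finset.mem_filter.mp hi).2.trans hz.1
        refine ⟨w, ⟨?_, hz⟩, rfl⟩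
        simp only [List.length_append, List.length_take] at hlen
        omega
      · rintro ⟨w, ⟨hlen, hz⟩, rfl⟩
        refine ⟨?_, hz⟩
        simp only [List.length_append, List.length_take]
        omega
    rw [himage, Set.ncard_image_of_injective _ (List.append_left_injective _)]
  rw [← Finset.sum_congr rfl hcard, hcover]
  have := (overlapLens S).finite_toSet.ncard_biUnion (s := B) (fun i _ => hBfin i) hdisj
  simp only [Finset.mem_coe] at this
  rw [this, ← finsum_mem_coe_finset]
  simp

/-- If `g` is the sequence of decrements of a nonnegative summable sequence `u`, then
`∑ n * g n = ∑ u n`. -/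
theorem hasSum_mul_decrement {u g : ℕ → ℝ} (hu : ∀ n, 0 ≤ u n) (hg : ∀ n, 0 ≤ g n)
    (hug : ∀ n, u n = u (n + 1) + g (n + 1)) (hsum : Summable u) :
    HasSum (fun n : ℕ => (n : ℝ) * g n) (∑' n, u n) := by
  have hanti : Antitone u := antitone_nat_of_succ_le fun n => by linarith [hug n, hg (n + 1)]
  have hpartial : ∀ N : ℕ, ∑ n ∈ Finset.range (N + 1), (n : ℝ) * g n =
      ∑ n ∈ Finset.range N, u n - N * u N := by
    intro N
    induction N with
    | zero => simp
    | succ N ih =>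
      rw [Finset.sum_range_succ, ih, Finset.sum_range_succ, hug N]
      push_cast
      ring
  have hlim : Filter.Tendsto (fun N : ℕ => (N : ℝ) * u N) Filter.atTop (nhds 0) := by
    have hs := hsum.hasSum.tendsto_sum_nat
    have hdiff := (hs.sub (hs.comp (Nat.tendsto_div_const_atTop two_ne_zero))).const_mul 2
    rw [sub_self, mul_zero] at hdiff
    refine squeeze_zero (fun N => mul_nonneg N.cast_nonneg (hu N)) (fun N => ?_) hdiff
    have hblock : ((N - N / 2 : ℕ) : ℝ) * u N ≤ ∑ n ∈ Finset.Ico (N / 2) N, u n := by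
      rw [← nsmul_eq_mul, ← Nat.card_Ico]
      exact Finset.card_nsmul_le_sum _ _ _ fun n hn => hanti (Finset.mem_Ico.mp hn).2.le
    rw [Finset.sum_Ico_eq_sub _ (Nat.div_le_self N 2)] at hblock
    have hhalf : (N : ℝ) ≤ 2 * (N - N / 2 : ℕ) := by
      exact_mod_cast (by omega : N ≤ 2 * (N - N / 2))
    calc (N : ℝ) * u N ≤ 2 * (N - N / 2 : ℕ) * u N := mul_le_mul_of_nonneg_right hhalf (hu N)
      _ ≤ _ := by rw [mul_assoc]; exact mul_le_mul_of_nonneg_left hblock zero_le_two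
  rw [hasSum_iff_tendsto_nat_of_nonneg fun n => mul_nonneg n.cast_nonneg (hg n)]
  rw [← Filter.tendsto_add_atTop_iff_nat 1]
  simpa [hpartial] using hsum.hasSum.tendsto_sum_nat.sub hlim

theorem dieP_uniform {m : ℕ} {p : Fin m → ℝ} (hp : ∀ i, p i = 1 / m) (w : List (Fin m)) :
    dieP p w = (1 / m : ℝ) ^ w.length := by
  simp [dieP, funext hp]

/-- For an unbiased die, the expected waiting time is computed from the number of words of
each length in `dieZ S`. -/
theorem dieE_uniform {m : ℕ} {p : Fin m → ℝ} (hp : ∀ i, p i = 1 / m) (S : List (Fin m)) {a : ℝ}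
    (h : HasSum (fun n : ℕ => (n : ℝ) * ((dieZOfLength S n).ncard * (1 / m : ℝ) ^ n)) a) :
    dieE p S = a := by
  let e := Equiv.sigmaFiberEquiv fun w : dieZ S => w.1.length
  have hfin : ∀ n, Finite {w : dieZ S // w.1.length = n} := fun n =>
    Set.Finite.subset ((dieZOfLength_finite S n).preimage Subtype.val_injective.injOn)
      (fun w (hw : w.1.length = n) => ⟨hw, w.2⟩)
  have hcard : ∀ n, Nat.card {w : dieZ S // w.1.length = n} = (dieZOfLength S n).ncard := by
    intro n
    refine Nat.card_congr ⟨fun w => ⟨w.1.1, w.2, w.1.2⟩, fun w => ⟨⟨w.1, w.2.2⟩, w.2.1⟩, ?_, ?_⟩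
    · intro w; rfl
    · intro w; rfl
  have hterm : ∀ x, ((e x).1.length : ℝ) * dieP p (e x).1 = (x.1 : ℝ) * (1 / m : ℝ) ^ x.1 := by
    rintro ⟨n, w, hw⟩
    rw [dieP_uniform hp]
    subst hw
    rfl
  have hfiber : ∀ n : ℕ, ∑' _ : {w : dieZ S // w.1.length = n}, (n : ℝ) * (1 / m : ℝ) ^ n =
      (n : ℝ) * ((dieZOfLength S n).ncard * (1 / m : ℝ) ^ n) := by
    intro n
    rw [tsum_const, hcard, nsmul_eq_mul]
    ring
  have hsummable : Summable fun x : Σ n, {w : dieZ S // w.1.length = n} =>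
      (x.1 : ℝ) * (1 / m : ℝ) ^ x.1 := by
    refine (summable_sigma_of_nonneg fun x => by positivity).mpr ⟨fun n => ?_, ?_⟩
    · have := hfin n
      exact Summable.of_finite
    · simpa only [hfiber] using h.summable
  rw [dieE, ← e.tsum_eq, tsum_congr hterm, hsummable.tsum_sigma]
  simp only [hfiber, h.tsum_eq]

/-- For an unbiased die, `E(S) = ∑_{R ∈ overlap(S)} m^{|R|}`. -/
theorem stmt_13 (m : ℕ) (hm : 1 ≤ m) (p : Fin m → ℝ) (hp : ∀ i, p i = 1 / m)
    (S : List (Fin m)) (hS : S ≠ []) :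
    dieE p S = ∑ i ∈ overlapLens S, (m : ℝ) ^ (i + 1) := by
  have hm0 : (m : ℝ) ≠ 0 := by positivity
  set u : ℕ → ℝ := fun n => (avoiders S n).ncard * (1 / m : ℝ) ^ n with hu_def
  set g : ℕ → ℝ := fun n => (dieZOfLength S n).ncard * (1 / m : ℝ) ^ n with hg_def
  have hu : ∀ n, 0 ≤ u n := fun n => by positivity
  have hg : ∀ n, 0 ≤ g n := fun n => by positivity
  have hug : ∀ n, u n = u (n + 1) + g (n + 1) := by
    intro n
    have h : ((avoiders S n).ncard * m : ℝ) =
        (avoiders S (n + 1)).ncard + (dieZOfLength S (n + 1)).ncard := by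
      exact_mod_cast card_avoiders_mul hS n
    simp only [hu_def, hg_def]
    rw [← add_mul, ← h, pow_succ]
    field_simp
  have hg_short : ∀ n < S.length, g n = 0 := by
    intro n hn
    have : dieZOfLength S n = ∅ := by
      refine Set.eq_empty_of_forall_notMem fun w hw => ?_
      have := hw.2.1.length_le
      have := hw.1
      omega
    simp [hg_def, this]
  have hu0 : u 0 = 1 := by
    have : avoiders S 0 = {[]} := by
      ext w
      simp only [avoiders, Set.mem_ofPred_eq, List.length_eq_zero_iff, Set.mem_singleton_iff]
      exact ⟨fun h => h.1, fun h => ⟨h, by simpa [h] using hS⟩⟩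
    simp [hu_def, this]
  have hg_partial : ∀ n, ∑ k ∈ Finset.range (n + 1), g k = 1 - u n := by
    intro n
    induction n with
    | zero => simp [hu0, hg_short 0 (List.length_pos_iff.mpr hS)]
    | succ n ih => rw [Finset.sum_range_succ, ih, hug n]; ring
  have hg_summable : Summable g := by
    refine summable_of_sum_range_le (c := 1) hg fun n => ?_
    refine (Finset.sum_le_sum_of_subset_of_nonneg (Finset.range_mono n.le_succ)
      fun i _ _ => hg i).trans ?_
    linarith [hg_partial n, hu n]
  have hu_sum : ∀ n, u n = ∑ i ∈ overlapLens S, (m : ℝ) ^ (i + 1) * g (n + (i + 1)) := by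
    intro n
    simp only [hu_def, hg_def]
    rw [card_avoiders_eq_sum hS, Nat.cast_sum, Finset.sum_mul]
    refine Finset.sum_congr rfl fun i _ => ?_
    rw [pow_add (1 / m : ℝ) n, one_div_pow (m : ℝ) (i + 1)]
    field_simp
  have hshift : ∀ i, Summable fun n => g (n + (i + 1)) := fun i =>
    (summable_nat_add_iff (i + 1)).mpr hg_summable
  have hu_summable : Summable u := by
    rw [funext hu_sum]
    exact summable_sum fun i _ => (hshift i).mul_left _
  have hg_tsum : ∑' n, g n = 1 := by
    have h1 := (Filter.tendsto_add_atTop_iff_nat 1).mpr hg_summable.hasSum.tendsto_sum_nat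
    have h2 := hu_summable.tendsto_atTop_zero.const_sub 1
    simp only [hg_partial] at h1
    simpa using tendsto_nhds_unique h1 h2
  refine dieE_uniform hp S ?_
  convert hasSum_mul_decrement hu hg hug hu_summable using 1
  rw [tsum_congr hu_sum, Summable.tsum_finsetSum fun i _ => (hshift i).mul_left _]
  refine Finset.sum_congr rfl fun i hi => ?_
  have hi' : i < S.length := by simpa using (Finset.mem_filter.mp hi).1
  have hsplit := hg_summable.sum_add_tsum_nat_add (i + 1)
  rw [Finset.sum_eq_zero fun k hk => hg_short k (by have := Finset.mem_range.mp hk; omega),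
    zero_add, hg_tsum] at hsplit
  rw [tsum_mul_left, hsplit, mul_one]
end
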